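/- arXiv:1804.04547 — 5 statements merged into one kernel-verified Lean document; each statement's English description precedes it below -/
import Mathlib

section
/- Let H₄ →b→ H₂ ⊗ ℤ/2ℤ →i→ P →h→ H₃ → 0 be any Γ-sequence. Then its group B of Γ-automorphisms is either the trivial group or contains an element of even order. -/
open TensorProduct

/-- A Γ-sequence (the `n ≥ 3` case, where `Γ_n^1 = - ⊗ ℤ/2ℤ`): an exact sequence of
abelian groups `H₄ →b→ H₂ ⊗ ℤ/2ℤ →i→ P →h→ H₃ → 0`. -/
structure GammaSeq (H₄ H₂ P H₃ : Type) [AddCommGroup H₄] [AddCommGroup H₂]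
    [AddCommGroup P] [AddCommGroup H₃] : Type where
  b : H₄ →ₗ[ℤ] H₂ ⊗[ℤ] ZMod 2
  i : H₂ ⊗[ℤ] ZMod 2 →ₗ[ℤ] P
  h : P →ₗ[ℤ] H₃
  exact_bi : Function.Exact b i
  exact_ih : Function.Exact i h
  h_surj : Function.Surjective h

variable {H₄ H₂ P H₃ : Type} [AddCommGroup H₄] [AddCommGroup H₂]
    [AddCommGroup P] [AddCommGroup H₃]

/-- The triple `(f₄, f₃, f₂)` of automorphisms is a Γ-automorphism of the Γ-sequence `S`:
there is a homomorphism `Ω : P → P` with `(f₂ ⊗ id) ∘ b = b ∘ f₄`, `Ω ∘ i = i ∘ (f₂ ⊗ id)`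
and `h ∘ Ω = f₃ ∘ h`. -/
def IsGammaAut (S : GammaSeq H₄ H₂ P H₃)
    (f : (H₄ ≃ₗ[ℤ] H₄) × (H₃ ≃ₗ[ℤ] H₃) × (H₂ ≃ₗ[ℤ] H₂)) : Prop :=
  ∃ Ω : P →ₗ[ℤ] P,
    (TensorProduct.map (f.2.2 : H₂ →ₗ[ℤ] H₂) (LinearMap.id : ZMod 2 →ₗ[ℤ] ZMod 2)) ∘ₗ S.b
        = S.b ∘ₗ (f.1 : H₄ →ₗ[ℤ] H₄) ∧
    Ω ∘ₗ S.i
        = S.i ∘ₗ TensorProduct.map (f.2.2 : H₂ →ₗ[ℤ] H₂) (LinearMap.id : ZMod 2 →ₗ[ℤ] ZMod 2) ∧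
    S.h ∘ₗ Ω = (f.2.1 : H₃ →ₗ[ℤ] H₃) ∘ₗ S.h

section VectorSpace

variable {K V : Type*} [Field K] [AddCommGroup V] [Module K V]

/-- A vector outside a line is detected by a functional vanishing on that line. -/
lemma exists_functional_of_notMem_span {v y : V} (hy : y ∉ Submodule.span K {v}) :
    ∃ l : V →ₗ[K] K, l ≠ 0 ∧ l v = 0 := by
  obtain ⟨l, hl, hle⟩ := Submodule.exists_le_ker_of_notMem hy
  refine ⟨l, fun h => hl (by simp [h]), ?_⟩
  exact hle (Submodule.mem_span_singleton_self v)

lemma smulRight_comp_self {l : V →ₗ[K] K} {v : V} (h : l v = 0) :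
    l.smulRight v ∘ₗ l.smulRight v = 0 := by
  ext z
  simp [h]

lemma smulRight_ne_zero {l : V →ₗ[K] K} {v : V} (hl : l ≠ 0) (hv : v ≠ 0) :
    l.smulRight v ≠ 0 := fun h =>
  hl (LinearMap.ext fun z => by simpa [hv] using LinearMap.congr_fun h z)

end VectorSpace

section ZModTwo

variable {V W : Type*} [AddCommGroup V] [Module (ZMod 2) V] [AddCommGroup W] [Module (ZMod 2) W]

lemma exists_functional_of_two_nonzero {x y : V} (hx : x ≠ 0) (hy : y ≠ 0) (hxy : x ≠ y) (v : V) :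
    ∃ l : V →ₗ[ZMod 2] ZMod 2, l ≠ 0 ∧ l v = 0 := by
  have mem : ∀ z ∈ Submodule.span (ZMod 2) {v}, z ≠ 0 → z = v := by
    intro z hz hz0
    obtain ⟨a, rfl⟩ := Submodule.mem_span_singleton.1 hz
    fin_cases a
    · exact absurd (zero_smul _ v) hz0
    · exact one_smul _ v
  by_cases hxv : x ∈ Submodule.span (ZMod 2) {v}
  · refine exists_functional_of_notMem_span (y := y) fun hyv => hxy ?_
    rw [mem x hxv hx, mem y hyv hy]
  · exact exists_functional_of_notMem_span hxv

/-- A linear map of `𝔽₂`-vector spaces commutes with a nonzero pair of square-zero endomorphisms,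
unless source and target are at most one-dimensional. -/
lemma exists_sq_zero_pair (φ : W →ₗ[ZMod 2] V)
    (hVW : (∃ x y : V, x ≠ 0 ∧ y ≠ 0 ∧ x ≠ y) ∨ ∃ x y : W, x ≠ 0 ∧ y ≠ 0 ∧ x ≠ y) :
    ∃ (m : V →ₗ[ZMod 2] V) (n : W →ₗ[ZMod 2] W), m ∘ₗ φ = φ ∘ₗ n ∧ m ∘ₗ m = 0 ∧ n ∘ₗ n = 0 ∧
      (m ≠ 0 ∨ n ≠ 0) := by
  by_cases hW : ∃ x y : W, x ≠ 0 ∧ y ≠ 0 ∧ x ≠ y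
  · obtain ⟨x, y, hx, hy, hxy⟩ := hW
    by_cases hφ : LinearMap.ker φ = ⊥
    · obtain ⟨g, hg⟩ := φ.exists_leftInverse_of_injective hφ
      have hg' : ∀ w, g (φ w) = w := LinearMap.congr_fun hg
      obtain ⟨l, hl, hlx⟩ := exists_functional_of_two_nonzero hx hy hxy x
      refine ⟨(l ∘ₗ g).smulRight (φ x), l.smulRight x, ?_, smulRight_comp_self (by simp [hg', hlx]),
        smulRight_comp_self hlx, Or.inr (smulRight_ne_zero hl hx)⟩
      ext w
      simp [hg']
    · obtain ⟨w, hw, hw0⟩ := Submodule.exists_mem_ne_zero_of_ne_bot hφ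
      obtain ⟨l, hl, hlw⟩ := exists_functional_of_two_nonzero hx hy hxy w
      refine ⟨0, l.smulRight w, ?_, by simp, smulRight_comp_self hlw, Or.inr (smulRight_ne_zero hl hw0)⟩
      ext z
      simp [LinearMap.mem_ker.1 hw]
  · obtain ⟨x, y, hx, hy, hxy⟩ := hVW.resolve_right hW
    push Not at hW
    obtain ⟨v, hv0, hv⟩ : ∃ v : V, v ≠ 0 ∧ ∀ w, φ w = 0 ∨ φ w = v := by
      by_cases hφ : ∃ w, φ w ≠ 0
      · obtain ⟨w, hw⟩ := hφ
        refine ⟨φ w, hw, fun z => or_iff_not_imp_left.2 fun hz => ?_⟩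
        rw [hW z w (fun h => hz (by simp [h])) (fun h => hw (by simp [h]))]
      · push Not at hφ
        exact ⟨x, hx, fun w => Or.inl (hφ w)⟩
    obtain ⟨l, hl, hlv⟩ := exists_functional_of_two_nonzero hx hy hxy v
    refine ⟨l.smulRight v, 0, ?_, smulRight_comp_self hlv, by simp, Or.inl (smulRight_ne_zero hl hv0)⟩
    ext w
    rcases hv w with h | h <;> simp [h, hlv]

lemma two_nsmul_eq_zero_of_zmodTwo (v : V) : (2 : ℕ) • v = 0 := by
  rw [← Nat.cast_smul_eq_nsmul (ZMod 2)]
  exact zero_smul (ZMod 2) v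

variable {P : Type*} [AddCommGroup P]

/-- The map `W → V` classifying an extension `V → P → W` of `𝔽₂`-vector spaces: it is
multiplication by two on lifts to `P`. -/
lemma exists_classifying_map (j : V →ₗ[ℤ] P) (h : P →ₗ[ℤ] W) (hj : Function.Injective j)
    (hjh : Function.Exact j h) (hh : Function.Surjective h) :
    ∃ φ : W →ₗ[ZMod 2] V, ∀ p, j (φ (h p)) = (2 : ℕ) • p := by
  have ex : ∀ w : W, ∃ v : V, ∀ p, h p = w → j v = (2 : ℕ) • p := by
    intro w
    obtain ⟨p, rfl⟩ := hh w
    obtain ⟨v, hv⟩ := (hjh ((2 : ℕ) • p)).1 (by rw [map_nsmul, two_nsmul_eq_zero_of_zmodTwo])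
    refine ⟨v, fun q hq => ?_⟩
    obtain ⟨u, hu⟩ := (hjh (q - p)).1 (by rw [map_sub, hq, sub_self])
    have := congrArg j (two_nsmul_eq_zero_of_zmodTwo u)
    rw [map_nsmul, hu, nsmul_sub, map_zero, sub_eq_zero] at this
    rw [hv, this]
  choose f hf using ex
  refine ⟨AddMonoidHom.toZModLinearMap 2 (AddMonoidHom.mk' f fun a b => hj ?_),
    fun p => hf _ p rfl⟩
  obtain ⟨p, rfl⟩ := hh a
  obtain ⟨q, rfl⟩ := hh b
  rw [map_add, hf _ p rfl, hf _ q rfl, hf _ (p + q) (map_add h p q), nsmul_add]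

/-- Endomorphisms of `V` and `W` compatible with the classifying map of an extension
`V → P → W` of `𝔽₂`-vector spaces extend to an endomorphism of `P`. -/
lemma exists_extension_endomorphism (j : V →ₗ[ℤ] P) (h : P →ₗ[ℤ] W) (hj : Function.Injective j)
    (hjh : Function.Exact j h) (hh : Function.Surjective h) (φ : W →ₗ[ZMod 2] V)
    (hφ : ∀ p, j (φ (h p)) = (2 : ℕ) • p) (m : V →ₗ[ZMod 2] V) (n : W →ₗ[ZMod 2] W)
    (hmn : m ∘ₗ φ = φ ∘ₗ n) :
    ∃ N : P →ₗ[ℤ] P, (∀ v, N (j v) = j (m v)) ∧ ∀ p, h (N p) = n (h p) := by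
  let B := Module.Basis.ofVectorSpace (ZMod 2) W
  choose s hs using hh
  let q : V × (Module.Basis.ofVectorSpaceIndex (ZMod 2) W →₀ ℤ) →ₗ[ℤ] P :=
    j.coprod (Finsupp.linearCombination ℤ fun k => s (B k))
  let t : V × (Module.Basis.ofVectorSpaceIndex (ZMod 2) W →₀ ℤ) →ₗ[ℤ] P :=
    (j ∘ₗ m.toAddMonoidHom.toIntLinearMap).coprod
      (Finsupp.linearCombination ℤ fun k => s (n (B k)))
  have hq : ∀ x, h (q x) = Finsupp.linearCombination ℤ (fun k => B k) x.2 := by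
    intro x
    simp [q, Finsupp.linearCombination_apply, Finsupp.sum, map_sum, hs, (hjh _).2 ⟨_, rfl⟩]
  have ht : ∀ x, h (t x) = n (h (q x)) := by
    intro x
    rw [hq]
    simp [t, Finsupp.linearCombination_apply, Finsupp.sum, map_sum, hs, (hjh _).2 ⟨_, rfl⟩]
  have hqs : Function.Surjective q := by
    intro p
    obtain ⟨a, ha⟩ : ∃ a : Module.Basis.ofVectorSpaceIndex (ZMod 2) W →₀ ℤ,
        Finsupp.linearCombination ℤ (fun k => B k) a = h p := by
      refine ⟨(B.repr (h p)).mapRange (fun c => (c.val : ℤ)) (by simp), ?_⟩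
      conv_rhs => rw [← B.linearCombination_repr (h p)]
      rw [Finsupp.linearCombination_apply, Finsupp.linearCombination_apply,
        Finsupp.sum_mapRange_index (by simp)]
      refine Finsupp.sum_congr fun k _ => ?_
      rw [← Int.cast_smul_eq_zsmul (ZMod 2)]
      simp
    obtain ⟨v, hv⟩ := (hjh (p - q (0, a))).1 (by rw [map_sub, hq, ha, sub_self])
    refine ⟨(v, 0) + (0, a), ?_⟩
    rw [map_add, show q (v, 0) = j v by simp [q], hv, sub_add_cancel]
  have hker : LinearMap.ker q ≤ LinearMap.ker t := by
    rintro ⟨v, a⟩ hx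
    rw [LinearMap.mem_ker] at hx ⊢
    have h0 := hq (v, a)
    rw [hx, map_zero] at h0
    have hcast : ∀ k, ((a k : ℤ) : ZMod 2) = 0 := by
      have hli := B.linearIndependent
      rw [linearIndependent_iff] at hli
      intro k
      have := hli (a.mapRange (fun c : ℤ => (c : ZMod 2)) (by simp)) (by
        rw [Finsupp.linearCombination_apply, Finsupp.sum_mapRange_index (by simp), h0,
          Finsupp.linearCombination_apply]
        refine Finsupp.sum_congr fun k _ => ?_
        rw [Int.cast_smul_eq_zsmul])
      simpa using DFunLike.congr_fun this k
    obtain ⟨c, rfl⟩ : ∃ c : Module.Basis.ofVectorSpaceIndex (ZMod 2) W →₀ ℤ,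
        a = (2 : ℕ) • c := by
      refine ⟨a.mapRange (fun z => z / 2) (by simp), Finsupp.ext fun k => ?_⟩
      have := (ZMod.intCast_zmod_eq_zero_iff_dvd _ 2).1 (hcast k)
      simp only [Finsupp.smul_apply, Finsupp.mapRange_apply, nsmul_eq_mul]
      push_cast at *
      omega
    have e1 : q (v, (2 : ℕ) • c) = j v + (2 : ℕ) • q (0, c) := by simp [q]
    have e2 : t (v, (2 : ℕ) • c) = j (m v) + (2 : ℕ) • t (0, c) := by simp [t]
    rw [e1, ← hφ, ← map_add] at hx
    have hv := hj (hx.trans (map_zero j).symm)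
    have hm := congrArg m hv
    rw [map_add, map_zero, show m (φ _) = φ (n _) from LinearMap.congr_fun hmn _] at hm
    rw [e2, ← hφ, ht, ← map_add, hm, map_zero]
  let N : P →ₗ[ℤ] P := (LinearMap.ker q).liftQ t hker ∘ₗ (q.quotKerEquivOfSurjective hqs).symm
  have hN : ∀ x, N (q x) = t x := by
    intro x
    have : (q.quotKerEquivOfSurjective hqs).symm (q x) = (LinearMap.ker q).mkQ x := by
      rw [LinearEquiv.symm_apply_eq]
      rfl
    simp only [N, LinearMap.comp_apply, LinearEquiv.coe_coe, this]
    rfl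
  refine ⟨N, fun v => ?_, fun p => ?_⟩
  · have := hN (v, 0)
    simpa [q, t] using this
  · obtain ⟨x, rfl⟩ := hqs p
    rw [hN, ht]

/-- The involution `1 + m` attached to a square-zero endomorphism of an `𝔽₂`-vector space. -/
def LinearMap.oneAddEquiv (m : V →ₗ[ZMod 2] V) (hm : m ∘ₗ m = 0) : V ≃ₗ[ℤ] V :=
  LinearEquiv.ofInvolutive (LinearMap.id + m.toAddMonoidHom.toIntLinearMap) fun v => by
    have h1 : m (m v) = 0 := LinearMap.congr_fun hm v
    have h2 := two_nsmul_eq_zero_of_zmodTwo (m v)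
    rw [two_nsmul] at h2
    simp [h1, add_assoc, h2]

@[simp] lemma LinearMap.oneAddEquiv_apply (m : V →ₗ[ZMod 2] V) (hm : m ∘ₗ m = 0) (v : V) :
    m.oneAddEquiv hm v = v + m v := rfl

lemma LinearMap.oneAddEquiv_sq (m : V →ₗ[ZMod 2] V) (hm : m ∘ₗ m = 0) :
    m.oneAddEquiv hm ^ 2 = 1 := by
  ext v
  rw [sq]
  exact (m.oneAddEquiv hm).symm_apply_apply v

lemma LinearMap.oneAddEquiv_eq_one_iff (m : V →ₗ[ZMod 2] V) (hm : m ∘ₗ m = 0) :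
    m.oneAddEquiv hm = 1 ↔ m = 0 := by
  refine ⟨fun h => LinearMap.ext fun v => ?_, fun h => LinearEquiv.ext fun v => ?_⟩
  · have := LinearEquiv.congr_fun h v
    simpa using this
  · simp [h]

/-- Tensoring an `𝔽₂`-vector space with `ℤ/2` over `ℤ` does not change it. -/
lemma tmul_one_bijective : Function.Bijective fun v : V => (v ⊗ₜ[ℤ] (1 : ZMod 2)) := by
  constructor
  · let g : V ⊗[ℤ] ZMod 2 →ₗ[ℤ] V :=
      TensorProduct.lift ((LinearMap.lsmul (ZMod 2) V).flip.restrictScalars₁₂ ℤ ℤ)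
    have hg : ∀ v, g (v ⊗ₜ 1) = v := one_smul (ZMod 2)
    exact Function.LeftInverse.injective hg
  · intro x
    induction x with
    | zero => exact ⟨0, TensorProduct.zero_tmul _ _⟩
    | add x y hx hy =>
      obtain ⟨a, rfl⟩ := hx
      obtain ⟨b, rfl⟩ := hy
      exact ⟨a + b, TensorProduct.add_tmul _ _ _⟩
    | tmul v c =>
      obtain ⟨k, rfl⟩ := ZMod.intCast_surjective c
      refine ⟨k • v, ?_⟩
      simp only
      rw [TensorProduct.smul_tmul, zsmul_one]

end ZModTwo

lemma exists_even_order_of_sq_eq_one {G : Type*} [Group G] {p : G → Prop} {f : G} (hp : p f)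
    (hf : f ^ 2 = 1) (hf1 : f ≠ 1) : ∃ f, p f ∧ orderOf f ≠ 0 ∧ 2 ∣ orderOf f := by
  have := orderOf_eq_prime hf hf1
  exact ⟨f, hp, by omega, by omega⟩

lemma LinearEquiv.neg_eq_one_iff {M : Type*} [AddCommGroup M] :
    LinearEquiv.neg ℤ (M := M) = 1 ↔ ∀ x : M, (2 : ℕ) • x = 0 := by
  rw [LinearEquiv.ext_iff]
  refine forall_congr' fun x => ?_
  rw [two_nsmul, LinearEquiv.neg_apply, LinearEquiv.coe_one, id, neg_eq_iff_add_eq_zero]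

lemma LinearEquiv.neg_sq {M : Type*} [AddCommGroup M] :
    LinearEquiv.neg ℤ (M := M) ^ 2 = 1 := by
  ext x
  simp [sq]

lemma LinearEquiv.eq_one_of_nonzero_unique {M : Type*} [AddCommGroup M]
    (hM : ∀ x y : M, x ≠ 0 → y ≠ 0 → x = y) (f : M ≃ₗ[ℤ] M) : f = 1 := by
  ext x
  by_cases hx : x = 0
  · simp [hx]
  · exact hM _ _ (by simpa using hx) hx

lemma isGammaAut_of_apply {S : GammaSeq H₄ H₂ P H₃} {f₄ : H₄ ≃ₗ[ℤ] H₄} {f₃ : H₃ ≃ₗ[ℤ] H₃}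
    {f₂ : H₂ ≃ₗ[ℤ] H₂} (Ω : P →ₗ[ℤ] P)
    (hb : ∀ x, TensorProduct.map (f₂ : H₂ →ₗ[ℤ] H₂) (LinearMap.id : ZMod 2 →ₗ[ℤ] ZMod 2) (S.b x) =
      S.b (f₄ x))
    (hi : ∀ x, Ω (S.i x) =
      S.i (TensorProduct.map (f₂ : H₂ →ₗ[ℤ] H₂) (LinearMap.id : ZMod 2 →ₗ[ℤ] ZMod 2) x))
    (hh : ∀ p, S.h (Ω p) = f₃ (S.h p)) : IsGammaAut S (f₄, f₃, f₂) :=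
  ⟨Ω, LinearMap.ext hb, LinearMap.ext hi, LinearMap.ext hh⟩

lemma isGammaAut_neg (S : GammaSeq H₄ H₂ P H₃) :
    IsGammaAut S (LinearEquiv.neg ℤ, LinearEquiv.neg ℤ, LinearEquiv.neg ℤ) := by
  have map_neg_id : ∀ x, TensorProduct.map ((LinearEquiv.neg ℤ : H₂ ≃ₗ[ℤ] H₂) : H₂ →ₗ[ℤ] H₂)
      (LinearMap.id : ZMod 2 →ₗ[ℤ] ZMod 2) x = -x := by
    intro x
    induction x with
    | zero => rw [map_zero, neg_zero]
    | add x y hx hy => rw [map_add, hx, hy, neg_add]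
    | tmul v c => simp [TensorProduct.neg_tmul]
  refine isGammaAut_of_apply (-LinearMap.id) (fun x => ?_) (fun x => ?_) fun p => ?_
  · rw [map_neg_id, LinearEquiv.neg_apply, map_neg]
  · rw [map_neg_id, map_neg]
    rfl
  · simp

/-- When `H₄ = 0` and `H₂`, `H₃` are `𝔽₂`-vector spaces, not both at most one-dimensional,
there is an involutive Γ-automorphism. -/
lemma exists_involution_of_zmodTwo [Subsingleton H₄] [Module (ZMod 2) H₂] [Module (ZMod 2) H₃]
    (S : GammaSeq H₄ H₂ P H₃)
    (hS : (∃ x y : H₂, x ≠ 0 ∧ y ≠ 0 ∧ x ≠ y) ∨ ∃ x y : H₃, x ≠ 0 ∧ y ≠ 0 ∧ x ≠ y) :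
    ∃ f, IsGammaAut S f ∧ f ^ 2 = 1 ∧ f ≠ 1 := by
  let j : H₂ →ₗ[ℤ] P := (AddMonoidHom.mk' (fun v => S.i (v ⊗ₜ 1)) fun v w => by
    rw [TensorProduct.add_tmul, map_add]).toIntLinearMap
  have hi : Function.Injective S.i := by
    rw [injective_iff_map_eq_zero]
    intro x hx
    obtain ⟨y, rfl⟩ := (S.exact_bi x).1 hx
    rw [Subsingleton.elim y 0, map_zero]
  have hj : Function.Injective j := hi.comp tmul_one_bijective.1
  have hjh : Function.Exact j S.h := by
    intro p
    rw [S.exact_ih p]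
    exact (tmul_one_bijective (V := H₂)).2.exists.trans Iff.rfl
  obtain ⟨φ, hφ⟩ := exists_classifying_map j S.h hj hjh S.h_surj
  obtain ⟨m, n, hmn, hm, hn, hne⟩ := exists_sq_zero_pair φ hS
  obtain ⟨N, hNj, hNh⟩ :=
    exists_extension_endomorphism j S.h hj hjh S.h_surj φ hφ m n hmn
  refine ⟨(1, n.oneAddEquiv hn, m.oneAddEquiv hm), isGammaAut_of_apply (LinearMap.id + N)
    (fun x => ?_) (fun x => ?_) (fun p => ?_), ?_, ?_⟩
  · rw [Subsingleton.elim x 0, map_zero, map_zero, map_zero, map_zero]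
  · obtain ⟨v, rfl⟩ := tmul_one_bijective.2 x
    have hN : N (S.i (v ⊗ₜ 1)) = S.i (m v ⊗ₜ 1) := hNj v
    simp only [LinearMap.add_apply, LinearMap.id_apply, hN, TensorProduct.map_tmul,
      LinearEquiv.coe_coe, LinearMap.oneAddEquiv_apply, TensorProduct.add_tmul, map_add]
  · simp [hNh]
  · simp [Prod.ext_iff, LinearMap.oneAddEquiv_sq]
  · simp only [ne_eq, Prod.ext_iff, Prod.fst_one, Prod.snd_one, true_and,
      LinearMap.oneAddEquiv_eq_one_iff]
    tauto

/-- The group of Γ-automorphisms of any Γ-sequence of finitely generated abelian groups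
(with `H₄` free abelian) is either trivial or contains an element of even order. -/
theorem stmt0 [AddGroup.FG H₄] [AddGroup.FG H₂] [AddGroup.FG P] [AddGroup.FG H₃]
    [Module.Free ℤ H₄] (S : GammaSeq H₄ H₂ P H₃) :
    (∀ f, IsGammaAut S f → f = 1) ∨
      (∃ f, IsGammaAut S f ∧ orderOf f ≠ 0 ∧ 2 ∣ orderOf f) := by
  by_cases h : (LinearEquiv.neg ℤ, LinearEquiv.neg ℤ, LinearEquiv.neg ℤ) =
      (1 : (H₄ ≃ₗ[ℤ] H₄) × (H₃ ≃ₗ[ℤ] H₃) × (H₂ ≃ₗ[ℤ] H₂))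
  · simp only [Prod.ext_iff, Prod.fst_one, Prod.snd_one, LinearEquiv.neg_eq_one_iff] at h
    obtain ⟨h4, h3, h2⟩ := h
    have : Subsingleton H₄ := subsingleton_of_forall_eq 0 fun x =>
      (smul_eq_zero.1 ((natCast_zsmul x 2).trans (h4 x))).resolve_left two_ne_zero
    let _ : Module (ZMod 2) H₃ := AddCommGroup.zmodModule h3
    let _ : Module (ZMod 2) H₂ := AddCommGroup.zmodModule h2
    by_cases hS : (∃ x y : H₂, x ≠ 0 ∧ y ≠ 0 ∧ x ≠ y) ∨ ∃ x y : H₃, x ≠ 0 ∧ y ≠ 0 ∧ x ≠ y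
    · obtain ⟨f, hf, hsq, hne⟩ := exists_involution_of_zmodTwo S hS
      exact Or.inr (exists_even_order_of_sq_eq_one hf hsq hne)
    · push Not at hS
      refine Or.inl fun f _ => Prod.ext (LinearEquiv.ext fun _ => Subsingleton.elim _ _)
        (Prod.ext ?_ ?_)
      · exact LinearEquiv.eq_one_of_nonzero_unique hS.2 _
      · exact LinearEquiv.eq_one_of_nonzero_unique hS.1 _
  · refine Or.inr (exists_even_order_of_sq_eq_one (isGammaAut_neg S) ?_ h)
    simp [Prod.ext_iff, LinearEquiv.neg_sq]
end

section
/- Let H₄ →b→ H₂ ⊗ ℤ/2ℤ →i→ P →h→ H₃ → 0 be a Γ-sequence in which the free abelian group H₄ has rank at least 2 (that is, H₄ ≅ ℤ² ⊕ G for some free abelian group G). Then the group B of Γ-automorphisms is infinite; indeed it contains an element of infinite order of the form (f₄, id, id). -/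
open TensorProduct

variable {H₄ H₂ P H₃ : Type} [AddCommGroup H₄] [AddCommGroup H₂]
    [AddCommGroup P] [AddCommGroup H₃]

theorem two_zsmul_tensor_zmod_two {A : Type*} [AddCommGroup A] (x : A ⊗[ℤ] ZMod 2) :
    (2 : ℤ) • x = 0 := by
  induction x with
  | zero => simp
  | add x y hx hy => rw [smul_add, hx, hy, add_zero]
  | tmul a z =>
    have hz : (2 : ℤ) • z = 0 := by revert z; decide
    rw [← TensorProduct.tmul_smul, hz, TensorProduct.tmul_zero]

/-- An automorphism of `H₄` over `b` gives a Γ-automorphism, witnessed by `Ω = id`. -/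
theorem isGammaAut_of_comp_eq (S : GammaSeq H₄ H₂ P H₃) (f₄ : H₄ ≃ₗ[ℤ] H₄)
    (hf : ∀ x, S.b (f₄ x) = S.b x) : IsGammaAut S (f₄, 1, 1) := by
  have hmap : TensorProduct.map ((1 : H₂ ≃ₗ[ℤ] H₂) : H₂ →ₗ[ℤ] H₂)
      (LinearMap.id : ZMod 2 →ₗ[ℤ] ZMod 2) = LinearMap.id := TensorProduct.map_id
  refine ⟨LinearMap.id, ?_, ?_, rfl⟩
  · rw [hmap]
    exact LinearMap.ext fun x => (hf x).symm
  · rw [hmap]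
    rfl

theorem transvection_pow_apply {R V : Type*} [CommRing R] [AddCommGroup V] [Module R V]
    {φ : Module.Dual R V} {v : V} (h : φ v = 0) (n : ℕ) (x : V) :
    (LinearEquiv.transvection h ^ n) x = x + (n * φ x) • v := by
  induction n with
  | zero => simp
  | succ n ih =>
    rw [pow_succ', LinearEquiv.mul_apply, ih, LinearEquiv.transvection.apply]
    simp only [map_add, map_smul, h, smul_zero, add_zero]
    push_cast
    module

/-- If the free abelian group `H₄` has rank at least 2, i.e. `H₄ ≅ ℤ² ⊕ G` with `G` free
abelian, then the group of Γ-automorphisms is infinite; indeed it contains an element of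
infinite order of the form `(f₄, id, id)`. -/
theorem stmt4 [AddGroup.FG H₄] [AddGroup.FG H₂] [AddGroup.FG P] [AddGroup.FG H₃]
    [Module.Free ℤ H₄] (S : GammaSeq H₄ H₂ P H₃)
    (G : Type) [AddCommGroup G] [Module.Free ℤ G] (e : H₄ ≃ₗ[ℤ] (ℤ × ℤ) × G) :
    {f : (H₄ ≃ₗ[ℤ] H₄) × (H₃ ≃ₗ[ℤ] H₃) × (H₂ ≃ₗ[ℤ] H₂) | IsGammaAut S f}.Infinite ∧
      ∃ f₄ : H₄ ≃ₗ[ℤ] H₄, IsGammaAut S (f₄, 1, 1) ∧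
        orderOf ((f₄, 1, 1) : (H₄ ≃ₗ[ℤ] H₄) × (H₃ ≃ₗ[ℤ] H₃) × (H₂ ≃ₗ[ℤ] H₂)) = 0 := by
  let φ : Module.Dual ℤ H₄ :=
    LinearMap.snd ℤ ℤ ℤ ∘ₗ LinearMap.fst ℤ (ℤ × ℤ) G ∘ₗ (e : H₄ →ₗ[ℤ] (ℤ × ℤ) × G)
  have hφ : φ (e.symm ((2, 0), 0)) = 0 := by simp [φ]
  let f₄ : H₄ ≃ₗ[ℤ] H₄ := LinearEquiv.transvection hφ
  have hb : S.b (e.symm ((2, 0), 0)) = 0 := by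
    have : (((2, 0), 0) : (ℤ × ℤ) × G) = (2 : ℤ) • ((1, 0), 0) := by simp
    rw [this, map_smul, map_smul, two_zsmul_tensor_zmod_two]
  have hbpow (n : ℕ) (x : H₄) : S.b ((f₄ ^ n) x) = S.b x := by
    rw [transvection_pow_apply, map_add, map_smul, hb, smul_zero, add_zero]
  have hinj : Function.Injective fun n : ℕ => f₄ ^ n := by
    intro m n hmn
    have h := congrArg e (DFunLike.congr_fun hmn (e.symm ((0, 1), 0)))
    simpa [f₄, transvection_pow_apply, φ] using h
  have hpow (n : ℕ) :
      ((f₄, 1, 1) : (H₄ ≃ₗ[ℤ] H₄) × (H₃ ≃ₗ[ℤ] H₃) × (H₂ ≃ₗ[ℤ] H₂)) ^ n = (f₄ ^ n, 1, 1) := by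
    simp [Prod.pow_mk]
  refine ⟨Set.infinite_of_injective_forall_mem (f := fun n : ℕ => (f₄ ^ n, 1, 1))
    (fun m n h => hinj (congrArg Prod.fst h))
    fun n => isGammaAut_of_comp_eq S _ (hbpow n), f₄, ?_, ?_⟩
  · exact isGammaAut_of_comp_eq S f₄ (by simpa using hbpow 1)
  · refine orderOf_eq_zero_iff.mpr (not_isOfFinOrder_of_injective_pow fun m n h => hinj ?_)
    simpa [hpow] using h
end

section
/- Let H₄ →b→ H₂ ⊗ ℤ/2ℤ →i→ P →h→ H₃ → 0 be a Γ-sequence and suppose there exists an h-split subgroup of H₃. Then the group B of Γ-automorphisms is either trivial or has an element of even order. -/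
open TensorProduct

variable {H₄ H₂ P H₃ : Type} [AddCommGroup H₄] [AddCommGroup H₂]
    [AddCommGroup P] [AddCommGroup H₃]

/-- In a group of exponent two, an element `y` outside `{0, x}` can be mapped to a prescribed
element `w` by a homomorphism which kills `x` and takes only the values `0` and `w`. -/
theorem exists_linearMap_of_exponent_two {V W : Type} [AddCommGroup V] [AddCommGroup W]
    (hV : ∀ v : V, 2 • v = 0) (hW : ∀ w : W, 2 • w = 0) {x y : V} (hy : y ≠ 0)
    (hxy : y ≠ x) (w : W) :
    ∃ δ : V →ₗ[ℤ] W, δ x = 0 ∧ δ y = w ∧ ∀ v, δ v = 0 ∨ δ v = w := by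
  let _ : Module (ZMod 2) V := AddCommGroup.zmodModule hV
  let _ : Module (ZMod 2) W := AddCommGroup.zmodModule hW
  have hspan : y ∉ Submodule.span (ZMod 2) {x} := by
    rw [Submodule.mem_span_singleton]
    rintro ⟨c, rfl⟩
    fin_cases c
    · exact hy (zero_smul _ _)
    · exact hxy (one_smul _ _)
  obtain ⟨ℓ, hℓy, hℓ⟩ := Submodule.exists_le_ker_of_notMem hspan
  have hℓx : ℓ x = 0 := hℓ (Submodule.mem_span_singleton_self x)
  have hcases : ∀ c : ZMod 2, c = 0 ∨ c = 1 := by decide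
  refine ⟨(ℓ.smulRight w).toAddMonoidHom.toIntLinearMap, ?_, ?_, fun v => ?_⟩
  · simp [hℓx]
  · simp [(hcases (ℓ y)).resolve_left hℓy]
  · rcases hcases (ℓ v) with h | h <;> simp [h]

/-- A group with at most one nonzero element has no nontrivial automorphisms. -/
theorem linearEquiv_eq_one_of_forall_eq {V : Type} [AddCommGroup V]
    (hV : ∀ x y : V, x ≠ 0 → y ≠ 0 → y = x) (f : V ≃ₗ[ℤ] V) : f = 1 := by
  ext v
  by_cases hv : v = 0
  · simp [hv]
  · exact hV v (f v) hv (by simpa using hv)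

/-- The transvection `1 + δ`, for `δ` of square zero on a group of exponent two. -/
def transvectionOfExponentTwo {V : Type} [AddCommGroup V] (hV : ∀ v : V, 2 • v = 0)
    (δ : V →ₗ[ℤ] V) (hδ : ∀ v, δ (δ v) = 0) : V ≃ₗ[ℤ] V :=
  LinearEquiv.ofInvolutive (LinearMap.id + δ) fun v => by
    have h := hV (δ v)
    rw [two_nsmul] at h
    simp only [LinearMap.add_apply, LinearMap.id_apply, map_add, hδ, add_zero]
    rw [add_assoc, h, add_zero]

theorem transvectionOfExponentTwo_sq {V : Type} [AddCommGroup V] (hV : ∀ v : V, 2 • v = 0)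
    (δ : V →ₗ[ℤ] V) (hδ : ∀ v, δ (δ v) = 0) :
    transvectionOfExponentTwo hV δ hδ ^ 2 = 1 := by
  ext v
  exact (transvectionOfExponentTwo hV δ hδ).left_inv v

theorem neg_linearEquiv_ne_one {V : Type} [AddCommGroup V] {v : V} (hv : 2 • v ≠ 0) :
    LinearEquiv.neg ℤ (M := V) ≠ 1 := by
  intro h
  have : -v = v := LinearEquiv.congr_fun h v
  rw [two_nsmul] at hv
  exact hv (by nth_rewrite 1 [← this]; simp)

theorem neg_linearEquiv_sq {V : Type} [AddCommGroup V] :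
    LinearEquiv.neg ℤ (M := V) ^ 2 = 1 := by
  ext v
  simp [pow_two]

theorem neg_tensor_zmod_two {V : Type} [AddCommGroup V] (t : V ⊗[ℤ] ZMod 2) : -t = t := by
  induction t with
  | zero => simp
  | tmul v c =>
    rw [← TensorProduct.tmul_neg]
    congr 1
    revert c
    decide
  | add s t hs ht => rw [neg_add, hs, ht]

theorem isGammaAut_neg_left (S : GammaSeq H₄ H₂ P H₃) :
    IsGammaAut S (LinearEquiv.neg ℤ, 1, 1) := by
  have h : TensorProduct.map ((1 : H₂ ≃ₗ[ℤ] H₂) : H₂ →ₗ[ℤ] H₂)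
      (LinearMap.id : ZMod 2 →ₗ[ℤ] ZMod 2) = LinearMap.id := TensorProduct.map_id
  refine ⟨LinearMap.id, ?_, ?_, rfl⟩
  · rw [h]
    refine LinearMap.ext fun v => ?_
    change S.b v = S.b (-v)
    rw [map_neg, neg_tensor_zmod_two]
  · rw [h]
    rfl

theorem isGammaAut_neg_middle (S : GammaSeq H₄ H₂ P H₃) :
    IsGammaAut S (1, LinearEquiv.neg ℤ, 1) := by
  have h : TensorProduct.map ((1 : H₂ ≃ₗ[ℤ] H₂) : H₂ →ₗ[ℤ] H₂)
      (LinearMap.id : ZMod 2 →ₗ[ℤ] ZMod 2) = LinearMap.id := TensorProduct.map_id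
  refine ⟨-LinearMap.id, ?_, ?_, LinearMap.ext fun p => map_neg S.h p⟩
  · rw [h]
    rfl
  · rw [h]
    refine LinearMap.ext fun v => ?_
    change -S.i v = S.i v
    rw [← map_neg, neg_tensor_zmod_two]

theorem isGammaAut_neg_right (S : GammaSeq H₄ H₂ P H₃) :
    IsGammaAut S (1, 1, LinearEquiv.neg ℤ) := by
  have h : TensorProduct.map ((LinearEquiv.neg ℤ : H₂ ≃ₗ[ℤ] H₂) : H₂ →ₗ[ℤ] H₂)
      (LinearMap.id : ZMod 2 →ₗ[ℤ] ZMod 2) = LinearMap.id := by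
    ext v
    simp [TensorProduct.neg_tmul, neg_tensor_zmod_two]
  refine ⟨LinearMap.id, ?_, ?_, rfl⟩
  · rw [h]
    rfl
  · rw [h]
    rfl

/-- An automorphism of `H₃` whose difference from the identity factors through `h` extends to a
Γ-automorphism. -/
theorem isGammaAut_of_sub_factors (S : GammaSeq H₄ H₂ P H₃) (f : H₃ ≃ₗ[ℤ] H₃)
    (δ : H₃ →ₗ[ℤ] P) (hf : ∀ v, f v = v + S.h (δ v)) : IsGammaAut S (1, f, 1) := by
  have h : TensorProduct.map ((1 : H₂ ≃ₗ[ℤ] H₂) : H₂ →ₗ[ℤ] H₂)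
      (LinearMap.id : ZMod 2 →ₗ[ℤ] ZMod 2) = LinearMap.id := TensorProduct.map_id
  refine ⟨LinearMap.id + δ ∘ₗ S.h, ?_, ?_, ?_⟩
  · rw [h]
    rfl
  · rw [h]
    refine LinearMap.ext fun v => ?_
    change S.i v + δ (S.h (S.i v)) = S.i v
    rw [S.exact_ih.apply_apply_eq_zero, map_zero, add_zero]
  · refine LinearMap.ext fun v => ?_
    simp [hf]

/-- If `i` has a retraction and `b = 0`, every automorphism of `H₂` extends to a
Γ-automorphism. -/
theorem isGammaAut_of_retraction (S : GammaSeq H₄ H₂ P H₃) (hb : S.b = 0)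
    (r : P →ₗ[ℤ] H₂ ⊗[ℤ] ZMod 2) (hr : r ∘ₗ S.i = LinearMap.id) (f : H₂ ≃ₗ[ℤ] H₂) :
    IsGammaAut S (1, 1, f) := by
  set F := TensorProduct.map (f : H₂ →ₗ[ℤ] H₂) (LinearMap.id : ZMod 2 →ₗ[ℤ] ZMod 2)
  have hr' : ∀ v, r (S.i v) = v := LinearMap.congr_fun hr
  refine ⟨LinearMap.id + S.i ∘ₗ (F - LinearMap.id) ∘ₗ r, ?_, ?_, ?_⟩
  · refine LinearMap.ext fun v => ?_
    change F (S.b v) = S.b v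
    rw [hb]
    exact map_zero F
  · refine LinearMap.ext fun v => ?_
    change S.i v + S.i (F (r (S.i v)) - r (S.i v)) = S.i (F v)
    rw [hr', ← map_add, add_sub_cancel]
  · refine LinearMap.ext fun v => ?_
    change S.h (v + S.i _) = S.h v
    rw [map_add, S.exact_ih.apply_apply_eq_zero, add_zero]

/-- A Γ-automorphism of order two is one of even order. -/
theorem exists_even_order_of_sq_eq_one_s8 (S : GammaSeq H₄ H₂ P H₃)
    {f : (H₄ ≃ₗ[ℤ] H₄) × (H₃ ≃ₗ[ℤ] H₃) × (H₂ ≃ₗ[ℤ] H₂)} (hf : IsGammaAut S f)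
    (h1 : f ≠ 1) (h2 : f ^ 2 = 1) :
    ∃ f, IsGammaAut S f ∧ orderOf f ≠ 0 ∧ 2 ∣ orderOf f :=
  ⟨f, hf, by simp [orderOf_eq_prime h2 h1], by simp [orderOf_eq_prime h2 h1]⟩

/-- If some (nontrivial) subgroup `A` of `H₃` is `h`-split, then the group of
Γ-automorphisms of the Γ-sequence is either trivial or has an element of even order. -/
theorem stmt9 [AddGroup.FG H₄] [AddGroup.FG H₂] [AddGroup.FG P] [AddGroup.FG H₃]
    [Module.Free ℤ H₄] (S : GammaSeq H₄ H₂ P H₃)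
    (A B C : Type) [AddCommGroup A] [AddCommGroup B] [AddCommGroup C] [Nontrivial A]
    (eP : P ≃ₗ[ℤ] A × B) (eH : H₃ ≃ₗ[ℤ] A × C) (g : B →ₗ[ℤ] C)
    (hsplit : ∀ p : P, eH (S.h p) = ((eP p).1, g (eP p).2)) :
    (∀ f, IsGammaAut S f → f = 1) ∨
      (∃ f, IsGammaAut S f ∧ orderOf f ≠ 0 ∧ 2 ∣ orderOf f) := by
  by_cases t4 : ∀ v : H₄, 2 • v = 0
  swap
  · push Not at t4
    obtain ⟨v, hv⟩ := t4
    exact .inr <| exists_even_order_of_sq_eq_one_s8 S (isGammaAut_neg_left S)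
      (fun h => neg_linearEquiv_ne_one hv (congrArg (fun f => f.1) h))
      (Prod.ext neg_linearEquiv_sq (one_pow 2))
  by_cases t3 : ∀ v : H₃, 2 • v = 0
  swap
  · push Not at t3
    obtain ⟨v, hv⟩ := t3
    exact .inr <| exists_even_order_of_sq_eq_one_s8 S (isGammaAut_neg_middle S)
      (fun h => neg_linearEquiv_ne_one hv (congrArg (fun f => f.2.1) h))
      (Prod.ext (one_pow 2) (Prod.ext neg_linearEquiv_sq (one_pow 2)))
  by_cases t2 : ∀ v : H₂, 2 • v = 0
  swap
  · push Not at t2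
    obtain ⟨v, hv⟩ := t2
    exact .inr <| exists_even_order_of_sq_eq_one_s8 S (isGammaAut_neg_right S)
      (fun h => neg_linearEquiv_ne_one hv (congrArg (fun f => f.2.2) h))
      (Prod.ext (one_pow 2) (Prod.ext (one_pow 2) neg_linearEquiv_sq))
  have h4 : ∀ v : H₄, v = 0 := fun v => by
    have h := t4 v
    rw [← Nat.cast_smul_eq_nsmul ℤ] at h
    exact (smul_eq_zero.1 h).resolve_left (by norm_num)
  have hb : S.b = 0 := LinearMap.ext fun v => by simp [h4 v]
  let s : A →ₗ[ℤ] P := eP.symm.toLinearMap ∘ₗ LinearMap.inl ℤ A B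
  have hs : ∀ a, S.h (s a) = eH.symm (a, 0) := fun a => by
    rw [LinearEquiv.eq_symm_apply, hsplit]
    simp [s]
  have tA : ∀ a : A, 2 • a = 0 := fun a => by
    have h := congrArg (fun v => (eH v).1) (t3 (eH.symm (a, 0)))
    simpa using h
  obtain ⟨a, ha⟩ := exists_ne (0 : A)
  by_cases c3 : ∀ y : H₃, y ≠ 0 → y = eH.symm (a, 0)
  swap
  · push Not at c3
    obtain ⟨y, hy, hya⟩ := c3
    obtain ⟨δ, hδx, hδy, hδ⟩ := exists_linearMap_of_exponent_two t3 tA hy hya a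
    have hsq : ∀ v, (S.h ∘ₗ s ∘ₗ δ) ((S.h ∘ₗ s ∘ₗ δ) v) = 0 := fun v => by
      rcases hδ v with h | h <;> simp [h, hs, hδx]
    refine .inr <| exists_even_order_of_sq_eq_one_s8 S
      (isGammaAut_of_sub_factors S (transvectionOfExponentTwo t3 _ hsq) (s ∘ₗ δ) fun v => rfl)
      (fun h => ?_)
      (Prod.ext (one_pow 2) (Prod.ext (transvectionOfExponentTwo_sq t3 _ hsq) (one_pow 2)))
    have h' : y + S.h (s (δ y)) = y := congrArg (fun f => f.2.1 y) h
    rw [hδy, hs, add_eq_left] at h'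
    simp [ha] at h'
  have hsection : ∃ l, S.h ∘ₗ l = LinearMap.id := by
    refine ⟨s ∘ₗ LinearMap.fst ℤ A C ∘ₗ eH.toLinearMap, LinearMap.ext fun v => ?_⟩
    by_cases hv : v = 0
    · simp [hv]
    · rw [c3 v hv]
      simp [hs]
  have hi : Function.Injective S.i := by
    rw [injective_iff_map_eq_zero]
    intro t ht
    obtain ⟨v, rfl⟩ := (S.exact_bi t).1 ht
    simp [hb]
  obtain ⟨r, hr⟩ := ((S.exact_ih.split_tfae hi S.h_surj).out 0 1).1 hsection
  by_cases c2 : ∀ x y : H₂, x ≠ 0 → y ≠ 0 → y = x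
  · refine .inl fun f _ => Prod.ext (linearEquiv_eq_one_of_forall_eq ?_ _)
      (Prod.ext (linearEquiv_eq_one_of_forall_eq ?_ _) (linearEquiv_eq_one_of_forall_eq c2 _))
    · exact fun x _ hx => absurd (h4 x) hx
    · exact fun x y hx hy => (c3 y hy).trans (c3 x hx).symm
  · push Not at c2
    obtain ⟨x, y, hx, hy, hxy⟩ := c2
    obtain ⟨δ, hδx, hδy, hδ⟩ := exists_linearMap_of_exponent_two t2 t2 hy hxy x
    have hsq : ∀ v, δ (δ v) = 0 := fun v => by
      rcases hδ v with h | h <;> simp [h, hδx]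
    refine .inr <| exists_even_order_of_sq_eq_one_s8 S
      (isGammaAut_of_retraction S hb r hr (transvectionOfExponentTwo t2 δ hsq))
      (fun h => ?_)
      (Prod.ext (one_pow 2) (Prod.ext (one_pow 2) (transvectionOfExponentTwo_sq t2 δ hsq)))
    have h' : y + δ y = y := congrArg (fun f => f.2.2 y) h
    rw [hδy, add_eq_left] at h'
    exact hx h'
end

section
/- Let h : P → H be a surjective homomorphism of finitely generated abelian groups whose kernel is a finite 2-group, and suppose H = A ⊕ D where the direct summand A is either free abelian or a finite group of odd order. Then A is h-split: there exist an isomorphism P ≅ A ⊕ B and a homomorphism g : B → D such that, under this isomorphism, h = id_A ⊕ g. -/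
/-- A homomorphism out of a group killed by `n` lifts along a surjection whose kernel is killed
by `m`, provided `m` and `n` are coprime. -/
theorem AddMonoidHom.exists_lift_of_coprime {P Q A : Type*} [AddCommGroup P] [AddCommGroup Q]
    [AddCommGroup A] (h : P →+ Q) (hsurj : Function.Surjective h) (f : A →+ Q) {m n : ℕ}
    (hmn : Nat.Coprime m n) (hm : ∀ x ∈ h.ker, m • x = 0) (hn : ∀ a : A, n • a = 0) :
    ∃ s : A →+ P, h.comp s = f := by
  obtain ⟨u, v, huv⟩ := Nat.isCoprime_iff_coprime.mpr hmn
  choose t ht using fun a => hsurj (f a)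
  have hadd (a b : A) : m • t (a + b) = m • t a + m • t b := by
    have := hm (t (a + b) - (t a + t b)) (by simp [AddMonoidHom.mem_ker, ht])
    rwa [smul_sub, smul_add, sub_eq_zero] at this
  refine ⟨AddMonoidHom.mk' (fun a => u • m • t a) fun a b => by rw [hadd, smul_add], ?_⟩
  ext a
  have ha : u • m • a = a := by
    have : (u * m + v * n) • a = a := by rw [huv, one_smul]
    simpa [add_smul, mul_smul, hn] using this
  simp only [AddMonoidHom.comp_apply, AddMonoidHom.mk'_apply, map_zsmul, map_nsmul, ht]
  rw [← map_nsmul, ← map_zsmul, ha]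

/-- A section of the first component of `h` that vanishes in the second component puts `h` in
the form `id ⊕ g`. -/
theorem AddMonoidHom.exists_eq_prodMap_of_section {P A D : Type*} [AddCommGroup P]
    [AddCommGroup A] [AddCommGroup D] (h : P →+ A × D) (s : A →+ P)
    (hs : ∀ a, h (s a) = (a, 0)) :
    ∃ (B : AddSubgroup P) (e : P ≃+ A × B) (g : B →+ D),
      ∀ p : P, h p = ((e p).1, g (e p).2) := by
  let f : P →+ A := (AddMonoidHom.fst A D).comp h
  have hf (a : A) : f (s a) = a := by simp [f, hs]
  refine ⟨f.ker,
    { toFun := fun p => (f p, ⟨p - s (f p), by simp [AddMonoidHom.mem_ker, hf]⟩)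
      invFun := fun x => s x.1 + x.2
      left_inv := fun p => by simp
      right_inv := fun x => by
        have hx : f x.2 = 0 := x.2.2
        ext <;> simp [hf, hx]
      map_add' := fun p q => by
        ext
        · simp
        · simp only [map_add, Prod.snd_add, AddSubgroup.coe_add]
          abel },
    ((AddMonoidHom.snd A D).comp h).comp f.ker.subtype, fun p => ?_⟩
  ext <;> simp [f, hs]

/-- Let `h : P → A ⊕ D` be a surjective homomorphism of finitely generated abelian groups
whose kernel is a finite 2-group, where the direct summand `A` is either free abelian or a
finite group of odd order.  Then `A` is `h`-split: there are an isomorphism `P ≅ A ⊕ B`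
and a homomorphism `g : B → D` under which `h` takes the form `id_A ⊕ g`. -/
theorem stmt11 (P A D : Type*) [AddCommGroup P] [AddCommGroup A] [AddCommGroup D]
    [AddGroup.FG P] [AddGroup.FG A] [AddGroup.FG D]
    (h : P →+ A × D) (hsurj : Function.Surjective h)
    (hker : ∃ n : ℕ, Nat.card h.ker = 2 ^ n)
    (hA : Module.Free ℤ A ∨ (Nat.card A ≠ 0 ∧ Odd (Nat.card A))) :
    ∃ (B : AddSubgroup P) (e : P ≃+ A × B) (g : B →+ D),
      ∀ p : P, h p = ((e p).1, g (e p).2) := by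
  suffices ∃ s : A →+ P, h.comp s = AddMonoidHom.inl A D by
    obtain ⟨s, hs⟩ := this
    exact h.exists_eq_prodMap_of_section s fun a => DFunLike.congr_fun hs a
  rcases hA with hfree | ⟨-, hodd⟩
  · obtain ⟨s, hs⟩ := Module.projective_lifting_property h.toIntLinearMap
      (AddMonoidHom.inl A D).toIntLinearMap hsurj
    exact ⟨s.toAddMonoidHom, by ext1 a; exact LinearMap.congr_fun hs a⟩
  · obtain ⟨k, hk⟩ := hker
    refine h.exists_lift_of_coprime hsurj _ (m := 2 ^ k) (n := Nat.card A)
      (hodd.coprime_two_left.pow_left k) (fun x hx => ?_) fun a => card_nsmul_eq_zero'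
    rw [← hk]
    exact congrArg Subtype.val (card_nsmul_eq_zero' (x := (⟨x, hx⟩ : h.ker)))
end

section
/- Let 0 → A →i→ P →h→ Q → 0 be a short exact sequence of finite abelian groups in which A ≅ (ℤ/2ℤ)^m and Q ≅ (ℤ/2ℤ)^k are elementary abelian. If no nonzero element of Q has a preimage under h of order 2 (equivalently, no subgroup of Q isomorphic to ℤ/2ℤ is h-split), then k ≤ m and P ≅ (ℤ/2ℤ)^{m−k} × (ℤ/4ℤ)^k. -/
/-- Elements of `P` annihilated by `n` are the images of the standard basis under a
homomorphism from `(ℤ/n)^k`. -/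
theorem exists_addMonoidHom_pi_zmod {P : Type*} [AddCommGroup P] (n : ℕ) {k : ℕ}
    (p : Fin k → P) (hp : ∀ j, n • p j = 0) :
    ∃ s : (Fin k → ZMod n) →+ P, ∀ x : Fin k → ℕ,
      s (fun j => (x j : ZMod n)) = ∑ j, x j • p j := by
  refine ⟨∑ j, (ZMod.lift n ⟨zmultiplesHom P (p j), by simpa using hp j⟩).comp
    (Pi.evalAddMonoidHom (fun _ : Fin k => ZMod n) j), fun x => ?_⟩
  rw [AddMonoidHom.finsetSum_apply]
  refine Finset.sum_congr rfl fun j _ => ?_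
  have := ZMod.lift_coe n ⟨zmultiplesHom P (p j), by simpa using hp j⟩ (x j : ℤ)
  simpa using this

/-- If `d : P → (ℤ/2)^m` has the same kernel as a surjection `h : P → Q` with `Q ≅ (ℤ/2)^k`, then
the range of `d` is a `k`-dimensional subspace. -/
theorem finrank_toZModSubmodule_range {P Q : Type*} [AddCommGroup P] [AddCommGroup Q] {m k : ℕ}
    (eQ : Q ≃+ (Fin k → ZMod 2)) (h : P →+ Q) (hs : Function.Surjective h)
    (d : P →+ (Fin m → ZMod 2)) (hker : d.ker = h.ker) :
    Module.finrank (ZMod 2) (AddSubgroup.toZModSubmodule 2 d.range) = k := by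
  have e : d.range ≃+ (Fin k → ZMod 2) :=
    (QuotientAddGroup.quotientKerEquivRange d).symm.trans
      ((QuotientAddGroup.quotientAddEquivOfEq hker).trans
        ((QuotientAddGroup.quotientKerEquivOfSurjective h hs).trans eQ))
  have hcard : Nat.card (AddSubgroup.toZModSubmodule 2 d.range) = 2 ^ k := by
    have := Nat.card_congr e.toEquiv
    simpa using this
  rw [Module.natCard_eq_pow_finrank (K := ZMod 2), Nat.card_zmod] at hcard
  exact Nat.pow_right_injective le_rfl hcard


/-- Let `0 → A →i→ P →h→ Q → 0` be a short exact sequence of finite abelian groups with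
`A ≅ (ℤ/2)^m` and `Q ≅ (ℤ/2)^k` elementary abelian.  If no nonzero element of `Q` has a
preimage under `h` of order 2 (i.e. every `p` with `h p ≠ 0` satisfies `p + p ≠ 0`), then
`k ≤ m` and `P ≅ (ℤ/2)^(m-k) × (ℤ/4)^k`. -/
theorem stmt14 (A P Q : Type*) [AddCommGroup A] [AddCommGroup P] [AddCommGroup Q]
    [Finite A] [Finite P] [Finite Q] (m k : ℕ)
    (eA : A ≃+ (Fin m → ZMod 2)) (eQ : Q ≃+ (Fin k → ZMod 2))
    (i : A →+ P) (h : P →+ Q)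
    (hi : Function.Injective i) (hs : Function.Surjective h)
    (hexact : Function.Exact i h)
    (hnosplit : ∀ p : P, h p ≠ 0 → p + p ≠ 0) :
    k ≤ m ∧ Nonempty (P ≃+ (Fin (m - k) → ZMod 2) × (Fin k → ZMod 4)) := by
  have add_self_A (a : A) : a + a = 0 := by
    apply eA.injective
    rw [map_add, map_zero]
    ext j
    exact CharTwo.add_self_eq_zero _
  have add_self_Q (q : Q) : q + q = 0 := by
    apply eQ.injective
    rw [map_add, map_zero]
    ext j
    exact CharTwo.add_self_eq_zero _
  have hdouble (p : P) : ∃ v : Fin m → ZMod 2, i (eA.symm v) = p + p := by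
    obtain ⟨a, ha⟩ := (hexact (p + p)).1 (by rw [map_add, add_self_Q])
    exact ⟨eA a, by simpa using ha⟩
  choose d₀ hd₀ using hdouble
  have hinj : Function.Injective fun v => i (eA.symm v) := hi.comp eA.symm.injective
  let d : P →+ (Fin m → ZMod 2) := AddMonoidHom.mk' d₀ fun p q => hinj <| by
    simp only [map_add, hd₀]
    abel
  have hd (p : P) : i (eA.symm (d p)) = p + p := hd₀ p
  have hker : d.ker = h.ker := by
    ext p
    rw [AddMonoidHom.mem_ker, AddMonoidHom.mem_ker]
    constructor
    · intro hp
      by_contra hne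
      exact hnosplit p hne (by rw [← hd p, hp, map_zero, map_zero])
    · intro hp
      obtain ⟨a, rfl⟩ := (hexact p).1 hp
      apply hinj
      simp only [hd, map_zero]
      rw [← map_add, add_self_A, map_zero]
  have hfin := finrank_toZModSubmodule_range eQ h hs d hker
  obtain ⟨C, hC⟩ := Submodule.exists_isCompl (AddSubgroup.toZModSubmodule 2 d.range)
  have hsum := Submodule.finrank_add_eq_of_isCompl hC
  rw [hfin, Module.finrank_fin_fun] at hsum
  have hkm : k ≤ m := by omega
  refine ⟨hkm, ?_⟩
  let eC : (Fin (m - k) → ZMod 2) ≃ₗ[ZMod 2] C :=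
    LinearEquiv.ofFinrankEq _ _ (by rw [Module.finrank_fin_fun]; omega)
  choose p hp using fun j : Fin k => hs (eQ.symm (Pi.single j 1))
  obtain ⟨s, hsp⟩ := exists_addMonoidHom_pi_zmod 4 p fun j => by
    have : (4 : ℕ) • p j = (p j + p j) + (p j + p j) := by abel
    rw [this, ← hd (p j), ← map_add, add_self_A, map_zero]
  have hsurj (q : Q) : ∃ x, h (s x) = q := by
    refine ⟨fun j => ((eQ q j).val : ZMod 4), ?_⟩
    rw [hsp]
    apply eQ.injective
    ext l
    simp [hp, Finset.sum_apply, Pi.single_apply, -ZMod.natCast_val]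
    exact ZMod.natCast_zmod_val _
  let F : (Fin (m - k) → ZMod 2) × (Fin k → ZMod 4) →+ P :=
    ((i.comp eA.symm.toAddMonoidHom).comp
      (C.subtype.comp eC.toLinearMap).toAddMonoidHom).coprod s
  have hF (c x) : F (c, x) = i (eA.symm (eC c : Fin m → ZMod 2)) + s x := rfl
  have hFsurj : Function.Surjective F := by
    intro p
    obtain ⟨x, hx⟩ := hsurj (h p)
    obtain ⟨a, ha⟩ := (hexact (p - s x)).1 (by rw [map_sub, hx, sub_self])
    obtain ⟨v, hv, w, hw, hvw⟩ := Submodule.mem_sup.1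
      (hC.sup_eq_top ▸ Submodule.mem_top : eA a ∈ AddSubgroup.toZModSubmodule 2 d.range ⊔ C)
    obtain ⟨p', rfl⟩ : ∃ p', d p' = v := hv
    obtain ⟨y, hy⟩ := hsurj (h p')
    have hdy : d p' = d (s y) := by
      rw [← sub_eq_zero, ← map_sub, ← AddMonoidHom.mem_ker, hker, AddMonoidHom.mem_ker,
        map_sub, hy, sub_self]
    refine ⟨(eC.symm ⟨w, hw⟩, x + (y + y)), ?_⟩
    have haw : a = eA.symm (d (s y)) + eA.symm w := by
      rw [← map_add, ← hdy, hvw, eA.symm_apply_apply]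
    rw [haw, map_add, hd] at ha
    rw [hF, LinearEquiv.apply_symm_apply, map_add, map_add, ← sub_add_cancel p (s x), ← ha]
    abel
  have hcardP : Nat.card P = 2 ^ m * 2 ^ k := by
    have hkerA : Nat.card h.ker = 2 ^ m := by
      have e : h.ker ≃+ A :=
        (AddEquiv.addSubgroupCongr (AddMonoidHom.exact_iff.1 hexact)).trans
          (AddMonoidHom.ofInjective hi).symm
      simpa using Nat.card_congr (e.trans eA).toEquiv
    have hquot : Nat.card (P ⧸ h.ker) = 2 ^ k := by
      simpa using Nat.card_congr
        ((QuotientAddGroup.quotientKerEquivOfSurjective h hs).trans eQ).toEquiv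
    rw [AddSubgroup.card_eq_card_quotient_mul_card_addSubgroup h.ker, hkerA, hquot, mul_comm]
  have hcard : Nat.card ((Fin (m - k) → ZMod 2) × (Fin k → ZMod 4)) = Nat.card P := by
    obtain ⟨n, rfl⟩ := Nat.exists_eq_add_of_le hkm
    rw [hcardP]
    have hfour : 4 ^ k = 2 ^ k * 2 ^ k := mul_pow 2 2 k
    simp only [Nat.card_prod, Nat.card_fun, Nat.card_zmod, Nat.card_fin, add_tsub_cancel_left,
      hfour]
    ring
  exact ⟨(AddEquiv.ofBijective F
    ((Nat.bijective_iff_surjective_and_card F).2 ⟨hFsurj, hcard⟩)).symm⟩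
end
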